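/- Let A = kQ/I be the gentle algebra over an algebraically closed field k with quiver Q having vertices 1,2,3,4,5,6 and arrows a_1: 1→2, a_2: 2→3, a_3: 3→1, a_4: 1→4, a_5: 2→5, a_6: 3→6, and I = ⟨a_1a_2, a_2a_3, a_3a_1⟩. Let M be the right A-module which is the uniserial module with top S(1) and socle S(4) (i.e. the indecomposable projective Ā-module at vertex 1 for Ā = A/Aε_2A, viewed as an A-module). Then: (i) Ext^1_A(a_2A, M) ≠ 0; (ii) M has infinite projective dimension as a right A-module; (iii) M has infinite injective dimension as a right A-module. -/

import Mathlib

/- Common infrastructure: finite quivers, path algebras, gentle algebras,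
   right modules, Gorenstein projective modules, etc. -/

open MulOpposite

noncomputable section

/-- A finite quiver, with `nV` vertices and `nE` arrows. -/
structure QuiverData where
  nV : ℕ
  nE : ℕ
  src : Fin nE → Fin nV
  tgt : Fin nE → Fin nV

/-- The relations defining the path algebra `kQ` as a quotient of the free
algebra on the set of vertices and arrows:  the trivial paths `e_v` are
orthogonal idempotents summing to `1`, and `e_{s(a)} * a = a = a * e_{t(a)}`.
(Paths are composed left-to-right, matching the paper's convention.) -/
inductive PathRel (k : Type) [Field k] (Q : QuiverData) :
    FreeAlgebra k (Fin Q.nV ⊕ Fin Q.nE) → FreeAlgebra k (Fin Q.nV ⊕ Fin Q.nE) → Prop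
  | vtx_mul (v w : Fin Q.nV) : PathRel k Q
      (FreeAlgebra.ι k (Sum.inl v) * FreeAlgebra.ι k (Sum.inl w))
      (if v = w then FreeAlgebra.ι k (Sum.inl v) else 0)
  | vtx_sum : PathRel k Q (∑ v : Fin Q.nV, FreeAlgebra.ι k (Sum.inl v)) 1
  | src_arr (e : Fin Q.nE) : PathRel k Q
      (FreeAlgebra.ι k (Sum.inl (Q.src e)) * FreeAlgebra.ι k (Sum.inr e))
      (FreeAlgebra.ι k (Sum.inr e))
  | arr_tgt (e : Fin Q.nE) : PathRel k Q
      (FreeAlgebra.ι k (Sum.inr e) * FreeAlgebra.ι k (Sum.inl (Q.tgt e)))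
      (FreeAlgebra.ι k (Sum.inr e))

/-- The path algebra `kQ`. -/
def PathAlg (k : Type) [Field k] (Q : QuiverData) := RingQuot (PathRel k Q)

instance (k : Type) [Field k] (Q : QuiverData) : Ring (PathAlg k Q) :=
  inferInstanceAs (Ring (RingQuot (PathRel k Q)))

instance (k : Type) [Field k] (Q : QuiverData) : Algebra k (PathAlg k Q) :=
  inferInstanceAs (Algebra k (RingQuot (PathRel k Q)))

/-- The arrow `e`, as an element of the path algebra. -/
def arr (k : Type) [Field k] (Q : QuiverData) (e : Fin Q.nE) : PathAlg k Q :=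
  RingQuot.mkAlgHom k (PathRel k Q) (FreeAlgebra.ι k (Sum.inr e))

/-- The trivial path (idempotent) at the vertex `v`, in the path algebra. -/
def vtx (k : Type) [Field k] (Q : QuiverData) (v : Fin Q.nV) : PathAlg k Q :=
  RingQuot.mkAlgHom k (PathRel k Q) (FreeAlgebra.ι k (Sum.inl v))

/-- Given a set `Rel` of (composable) pairs of arrows, the relation on `kQ`
identifying each corresponding length-two path with `0`; the quotient is
`kQ/I` where `I` is the two-sided ideal generated by these paths of length two. -/
def GRel (k : Type) [Field k] (Q : QuiverData) (Rel : Set (Fin Q.nE × Fin Q.nE)) :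
    PathAlg k Q → PathAlg k Q → Prop := fun x y =>
  (∃ p ∈ Rel, x = arr k Q p.1 * arr k Q p.2) ∧ y = 0

/-- The algebra `A = kQ/I`. -/
def GAlg (k : Type) [Field k] (Q : QuiverData) (Rel : Set (Fin Q.nE × Fin Q.nE)) :=
  RingQuot (GRel k Q Rel)

instance (k : Type) [Field k] (Q : QuiverData) (Rel : Set (Fin Q.nE × Fin Q.nE)) :
    Ring (GAlg k Q Rel) := inferInstanceAs (Ring (RingQuot (GRel k Q Rel)))

instance (k : Type) [Field k] (Q : QuiverData) (Rel : Set (Fin Q.nE × Fin Q.nE)) :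
    Algebra k (GAlg k Q Rel) := inferInstanceAs (Algebra k (RingQuot (GRel k Q Rel)))

/-- The canonical projection `kQ → kQ/I`. -/
def gmap (k : Type) [Field k] (Q : QuiverData) (Rel : Set (Fin Q.nE × Fin Q.nE)) :
    PathAlg k Q →ₐ[k] GAlg k Q Rel := RingQuot.mkAlgHom k (GRel k Q Rel)

/-- Membership in the ideal `I` (the kernel of `kQ → kQ/I`). -/
def inI (k : Type) [Field k] (Q : QuiverData) (Rel : Set (Fin Q.nE × Fin Q.nE))
    (x : PathAlg k Q) : Prop := gmap k Q Rel x = 0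

/-- The idempotent `ε_v ∈ A` at a vertex `v`. -/
def vtxA (k : Type) [Field k] (Q : QuiverData) (Rel : Set (Fin Q.nE × Fin Q.nE))
    (v : Fin Q.nV) : GAlg k Q Rel := gmap k Q Rel (vtx k Q v)

/-- The image in `A` of an arrow `e`. -/
def arrA (k : Type) [Field k] (Q : QuiverData) (Rel : Set (Fin Q.nE × Fin Q.nE))
    (e : Fin Q.nE) : GAlg k Q Rel := gmap k Q Rel (arr k Q e)

/-- `(Q, I)` is a gentle pair (with `I` the ideal generated by the length-two
paths coming from `Rel`), and moreover `I` is admissible. -/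
structure IsGentle (k : Type) [Field k] (Q : QuiverData)
    (Rel : Set (Fin Q.nE × Fin Q.nE)) : Prop where
  /-- the generating relations are composable length-two paths -/
  comp_rel : ∀ p ∈ Rel, Q.tgt p.1 = Q.src p.2
  /-- every vertex is the source of at most two arrows -/
  src_card : ∀ v, (Finset.univ.filter fun e => Q.src e = v).card ≤ 2
  /-- every vertex is the target of at most two arrows -/
  tgt_card : ∀ v, (Finset.univ.filter fun e => Q.tgt e = v).card ≤ 2
  /-- for each arrow `a` there is at most one arrow `b` with `ab ∉ I` -/
  uniq_nonrel_right : ∀ a b c, ¬ inI k Q Rel (arr k Q a * arr k Q b) →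
    ¬ inI k Q Rel (arr k Q a * arr k Q c) → b = c
  /-- for each arrow `a` there is at most one arrow `c` with `ca ∉ I` -/
  uniq_nonrel_left : ∀ a b c, ¬ inI k Q Rel (arr k Q b * arr k Q a) →
    ¬ inI k Q Rel (arr k Q c * arr k Q a) → b = c
  /-- for each arrow `a` there is at most one (composable) arrow `b` with `ab ∈ I` -/
  uniq_rel_right : ∀ a b c, Q.tgt a = Q.src b → Q.tgt a = Q.src c →
    inI k Q Rel (arr k Q a * arr k Q b) → inI k Q Rel (arr k Q a * arr k Q c) → b = c
  /-- for each arrow `a` there is at most one (composable) arrow `c` with `ca ∈ I` -/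
  uniq_rel_left : ∀ a b c, Q.tgt b = Q.src a → Q.tgt c = Q.src a →
    inI k Q Rel (arr k Q b * arr k Q a) → inI k Q Rel (arr k Q c * arr k Q a) → b = c
  /-- admissibility: some power of the arrow ideal is contained in `I` -/
  admissible : ∃ m, 2 ≤ m ∧ ∀ f : Fin m → Fin Q.nE,
    inI k Q Rel (List.ofFn fun i => arr k Q (f i)).prod

/-- A full-relational oriented cycle `𝒞 = a_1 ⋯ a_len` (of length ≥ 3, as assumed
throughout the paper) in the bound quiver `(Q, I)`, encoded by a periodic
sequence of arrows.  `arrows i` is the arrow `a_{i+1}` (`0`-indexed),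
consecutive arrows are composable, all consecutive length-two paths lie in `I`,
and the vertices of the cycle are pairwise distinct. -/
structure FRCycle (k : Type) [Field k] (Q : QuiverData)
    (Rel : Set (Fin Q.nE × Fin Q.nE)) where
  len : ℕ
  len3 : 3 ≤ len
  arrows : ℕ → Fin Q.nE
  periodic : ∀ i, arrows (i + len) = arrows i
  comp : ∀ i, Q.tgt (arrows i) = Q.src (arrows (i + 1))
  frel : ∀ i, inI k Q Rel (arr k Q (arrows i) * arr k Q (arrows (i + 1)))
  vinj : ∀ i j, i < len → j < len → Q.src (arrows i) = Q.src (arrows j) → i = j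

/-- There are no full-relational oriented cycles of length `< 3` (the blanket
assumption of the paper). -/
def NoShortFRC (k : Type) [Field k] (Q : QuiverData)
    (Rel : Set (Fin Q.nE × Fin Q.nE)) : Prop :=
  ∀ (l : ℕ) (c : ℕ → Fin Q.nE), 1 ≤ l → (∀ i, c (i + l) = c i) →
    (∀ i, Q.tgt (c i) = Q.src (c (i + 1))) →
    (∀ i, inI k Q Rel (arr k Q (c i) * arr k Q (c (i + 1)))) → 3 ≤ l

/-- The set of arrows lying on the cycle. -/
def FRCycle.arrowSet {k : Type} [Field k] {Q : QuiverData}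
    {Rel : Set (Fin Q.nE × Fin Q.nE)} (C : FRCycle k Q Rel) : Set (Fin Q.nE) :=
  {a | ∃ i < C.len, C.arrows i = a}

/-- The idempotent `ε_{𝒞,t} ∈ A`: the sum of the `ε_v` over the vertices `v`
of the cycle `𝒞` other than `s(a_t)` and `t(a_t)`. -/
def epsCt (k : Type) [Field k] (Q : QuiverData) (Rel : Set (Fin Q.nE × Fin Q.nE))
    (C : FRCycle k Q Rel) (t : ℕ) : GAlg k Q Rel :=
  ∑ i ∈ (Finset.range C.len).filter
      (fun i => Q.src (C.arrows i) ≠ Q.src (C.arrows t) ∧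
        Q.src (C.arrows i) ≠ Q.tgt (C.arrows t)),
    vtxA k Q Rel (Q.src (C.arrows i))

/-- The relation identifying an element `ε` of a ring with `0`; the quotient is
`R/RεR`. -/
def QuotRel (R : Type) [Ring R] (ε : R) : R → R → Prop := fun x y => x = ε ∧ y = 0

/-- The quotient ring `R/RεR`. -/
def QuotBy (R : Type) [Ring R] (ε : R) := RingQuot (QuotRel R ε)

instance (R : Type) [Ring R] (ε : R) : Ring (QuotBy R ε) :=
  inferInstanceAs (Ring (RingQuot (QuotRel R ε)))

/-- The canonical projection `R → R/RεR`. -/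
def qmap (R : Type) [Ring R] (ε : R) : R →+* QuotBy R ε := RingQuot.mkRingHom (QuotRel R ε)

/-- The right ideal `xR`, as a right `R`-module (i.e. an `Rᵐᵒᵖ`-submodule of `R`). -/
def rIdeal (R : Type) [Ring R] (x : R) : Submodule Rᵐᵒᵖ R := Submodule.span Rᵐᵒᵖ {x}

/-- Restriction of scalars along `π : R →+* S` turns a right `S`-module into a
right `R`-module. -/
def modRestrict {R S : Type} [Ring R] [Ring S] (π : R →+* S) (M : Type)
    [AddCommGroup M] [Module Sᵐᵒᵖ M] : Module Rᵐᵒᵖ M :=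
  Module.compHom M (RingHom.op π)

/-- `M` is a Gorenstein projective right `R`-module:  there is a complete
resolution, i.e. an exact sequence `⋯ → P⁻² → P⁻¹ → P⁰ → P¹ → ⋯` of finitely
generated projective right `R`-modules which stays exact after applying
`Hom_R(-, R)`, with `M ≅ Im(P⁻¹ → P⁰)`. -/
def IsGProjMod (R : Type) [Ring R] (M : Type) [AddCommGroup M] [Module Rᵐᵒᵖ M] : Prop :=
  ∃ (P : ℤ → ModuleCat.{0} Rᵐᵒᵖ) (d : (n : ℤ) → (P n →ₗ[Rᵐᵒᵖ] P (n + 1))),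
    (∀ n, Module.Finite Rᵐᵒᵖ (P n)) ∧
    (∀ n, Module.Projective Rᵐᵒᵖ (P n)) ∧
    (∀ n, LinearMap.range (d n) = LinearMap.ker (d (n + 1))) ∧
    (∀ (n : ℤ) (g : P (n + 1) →ₗ[Rᵐᵒᵖ] R),
      g.comp (d n) = 0 ↔ ∃ h : P (n + 1 + 1) →ₗ[Rᵐᵒᵖ] R, h.comp (d (n + 1)) = g) ∧
    Nonempty (M ≃ₗ[Rᵐᵒᵖ] LinearMap.range (d (-1)))

/-- `M` is an indecomposable `S`-module. -/
def IsIndec (S : Type) [Ring S] (M : Type) [AddCommGroup M] [Module S M] : Prop :=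
  Nontrivial M ∧ ∀ N₁ N₂ : Submodule S M, IsCompl N₁ N₂ → N₁ = ⊥ ∨ N₂ = ⊥

/-- `M` is a non-projective indecomposable Gorenstein projective right `R`-module. -/
def IsNPIGProj (R : Type) [Ring R] (M : Type) [AddCommGroup M] [Module Rᵐᵒᵖ M] : Prop :=
  IsGProjMod R M ∧ IsIndec Rᵐᵒᵖ M ∧ ¬ Module.Projective Rᵐᵒᵖ M

/-- A right `S`-module `M`, viewed as a right `R`-module along `π : R →+* S`, is a
non-projective indecomposable Gorenstein projective right `R`-module. -/
def RestrIsNPIGProj {R S : Type} [Ring R] [Ring S] (π : R →+* S) (M : Type)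
    [AddCommGroup M] [Module Sᵐᵒᵖ M] : Prop :=
  letI := modRestrict π M
  IsNPIGProj R M

/-- The submodule `M·(RεR)` of a right `R`-module `M`;  the quotient
`M ⧸ M·(RεR)` realizes the tensor product `M ⊗_R R/RεR`. -/
def smulIdeal (R : Type) [Ring R] (ε : R) (M : Type) [AddCommGroup M]
    [Module Rᵐᵒᵖ M] : Submodule Rᵐᵒᵖ M :=
  Submodule.span Rᵐᵒᵖ {m | ∃ (x : M) (a b : R), m = (op (a * ε * b)) • x}

/-- `S` has finitely many finitely generated indecomposable modules up to
isomorphism.  (Applied with `S = Aᵐᵒᵖ` this says `A` is representation-finite.) -/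
def RepFinite (S : Type) [Ring S] : Prop :=
  ∃ (n : ℕ) (M : Fin n → ModuleCat.{0} S), ∀ N : ModuleCat.{0} S,
    Module.Finite S N → IsIndec S N → ∃ i, Nonempty (N ≃ₗ[S] M i)

/-- A cycle in the underlying undirected graph of `Q`:  a closed walk of
length ≥ 1 along edges (each traversed forwards or backwards) with pairwise
distinct vertices and pairwise distinct edges. -/
structure UCycle (Q : QuiverData) where
  len : ℕ
  len1 : 1 ≤ len
  edges : ℕ → Fin Q.nE
  dir : ℕ → Bool
  vert : ℕ → Fin Q.nV
  pe : ∀ i, edges (i + len) = edges i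
  pd : ∀ i, dir (i + len) = dir i
  pv : ∀ i, vert (i + len) = vert i
  incid_t : ∀ i, dir i = true →
    Q.src (edges i) = vert i ∧ Q.tgt (edges i) = vert (i + 1)
  incid_f : ∀ i, dir i = false →
    Q.tgt (edges i) = vert i ∧ Q.src (edges i) = vert (i + 1)
  vdist : ∀ i j, i < len → j < len → vert i = vert j → i = j
  edist : ∀ i j, i < len → j < len → edges i = edges j → i = j

/-- The set of edges of an undirected cycle. -/
def UCycle.edgeSet {Q : QuiverData} (C : UCycle Q) : Set (Fin Q.nE) :=
  {e | ∃ i < C.len, C.edges i = e}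

/-- The underlying graph of `Q` has exactly one cycle. -/
def OneCycle (Q : QuiverData) : Prop :=
  Nonempty (UCycle Q) ∧ ∀ C C' : UCycle Q, C.edgeSet = C'.edgeSet

/-- The projective dimension of (the module underlying) `M` is at most `n`. -/
def projDimLE (S : Type) [Ring S] : ℕ → ModuleCat.{0} S → Prop
  | 0, M => Module.Projective S M
  | n + 1, M => ∃ (P : ModuleCat.{0} S) (f : P →ₗ[S] M), Module.Projective S P ∧
      Function.Surjective f ∧ projDimLE S n (ModuleCat.of S (LinearMap.ker f))

/-- The injective dimension of (the module underlying) `M` is at most `n`. -/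
def injDimLE (S : Type) [Ring S] : ℕ → ModuleCat.{0} S → Prop
  | 0, M => Module.Injective S M
  | n + 1, M => ∃ (J : ModuleCat.{0} S) (f : M →ₗ[S] J), Module.Injective S J ∧
      Function.Injective f ∧ injDimLE S n (ModuleCat.of S (J ⧸ LinearMap.range f))

end

/-- The quiver of Statement 15:  vertices `1,…,6` (encoded `0,…,5`) and arrows
`a_1 : 1→2`, `a_2 : 2→3`, `a_3 : 3→1`, `a_4 : 1→4`, `a_5 : 2→5`, `a_6 : 3→6`
(encoded `0,…,5`). -/
abbrev Q15 : QuiverData := ⟨6, 6, ![0, 1, 2, 0, 1, 2], ![1, 2, 0, 3, 4, 5]⟩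

/-- The relations `a_1a_2, a_2a_3, a_3a_1` of Statement 15. -/
def Rel15 : Set (Fin Q15.nE × Fin Q15.nE) := {(0, 1), (1, 2), (2, 0)}

section Periodic

open CategoryTheory

variable {S : Type} [Ring S]

theorem hasProjectiveDimensionLT_of_projDimLE (n : ℕ) (N : ModuleCat.{0} S)
    (h : projDimLE S n N) : HasProjectiveDimensionLT N (n + 1) := by
  induction n generalizing N with
  | zero =>
    have : Module.Projective S N := h
    have : Projective N := N.projective_of_categoryTheory_projective
    infer_instance
  | succ n ih =>
    obtain ⟨P, f, hP, hf, hK⟩ := h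
    have : Projective P := P.projective_of_categoryTheory_projective
    exact ((LinearMap.shortExact_shortComplexKer hf).hasProjectiveDimensionLT_X₃_iff n this).2
      (ih _ hK)

/-- A family of short exact sequences `0 → K (i + 1) → P i → K i → 0` with projective middle
terms, the indices being taken modulo `3`. -/
structure PeriodicResolution (S : Type) [Ring S] where
  K : Fin 3 → ModuleCat.{0} S
  P : Fin 3 → ModuleCat.{0} S
  f : ∀ i, K (i + 1) →ₗ[S] P i
  g : ∀ i, P i →ₗ[S] K i
  projective : ∀ i, Module.Projective S (P i)
  injective : ∀ i, Function.Injective (f i)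
  surjective : ∀ i, Function.Surjective (g i)
  exact : ∀ i, Function.Exact (f i) (g i)
  nonsplit : ∀ i, ¬ ∃ s : K i →ₗ[S] P i, (g i).comp s = LinearMap.id

namespace PeriodicResolution

variable (R : PeriodicResolution S)

theorem not_projective (i : Fin 3) : ¬ Module.Projective S (R.K i) := fun _ =>
  R.nonsplit i (Module.projective_lifting_property (R.g i) LinearMap.id (R.surjective i))

theorem not_hasProjectiveDimensionLT (n : ℕ) (i : Fin 3) :
    ¬ HasProjectiveDimensionLT (R.K i) (n + 1) := by
  induction n generalizing i with
  | zero =>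
    intro h
    exact R.not_projective i
      ((IsProjective.iff_projective _).2 (projective_iff_hasProjectiveDimensionLT_one.2 h))
  | succ n ih =>
    intro h
    have := R.projective i
    have hP : Projective (R.P i) := (R.P i).projective_of_categoryTheory_projective
    have hS := ModuleCat.shortComplex_shortExact
      (ModuleCat.shortComplexOfCompEqZero (R.f i) (R.g i) (R.exact i).linearMap_comp_eq_zero)
      (R.exact i) (R.injective i) (R.surjective i)
    exact ih (i + 1) ((hS.hasProjectiveDimensionLT_X₃_iff n hP).1 h)

theorem not_projDimLE {N : ModuleCat.{0} S} {i : Fin 3} (e : N ≃ₗ[S] R.K i) (n : ℕ) :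
    ¬ projDimLE S n N := fun h =>
  have := hasProjectiveDimensionLT_of_projDimLE n N h
  R.not_hasProjectiveDimensionLT n i (hasProjectiveDimensionLT_of_iso e.toModuleIso (n + 1))

/-- The vanishing of all `Ext¹ (K i, N)`. -/
def Extends (N : Type) [AddCommGroup N] [Module S N] : Prop :=
  ∀ i, ∀ φ : R.K (i + 1) →ₗ[S] N, ∃ ψ : R.P i →ₗ[S] N, ψ.comp (R.f i) = φ

theorem extends_of_injective (N : Type) [AddCommGroup N] [Module S N] [h : Module.Injective S N] :
    R.Extends N := fun i φ =>
  let ⟨ψ, hψ⟩ := h.out (R.f i) (R.injective i) φ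
  ⟨ψ, LinearMap.ext hψ⟩

theorem extends_of_quotient {N J : Type} [AddCommGroup N] [Module S N] [AddCommGroup J]
    [Module S J] [Module.Injective S J] (u : N →ₗ[S] J) (hu : Function.Injective u)
    (h : R.Extends (J ⧸ LinearMap.range u)) : R.Extends N := by
  intro i φ
  obtain ⟨i, rfl⟩ : ∃ j, i = j + 1 := ⟨i - 1, by simp⟩
  obtain ⟨α, hα⟩ := R.extends_of_injective J (i + 1) (u.comp φ)
  have hker : LinearMap.ker (R.g (i + 1)) ≤
      LinearMap.ker ((LinearMap.range u).mkQ.comp α) := by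
    intro x hx
    obtain ⟨y, rfl⟩ := (R.exact (i + 1) x).1 hx
    have := LinearMap.congr_fun hα y
    simp only [LinearMap.comp_apply] at this
    simp [this]
  let β : R.K (i + 1) →ₗ[S] J ⧸ LinearMap.range u :=
    ((LinearMap.ker (R.g (i + 1))).liftQ _ hker).comp
      ((R.g (i + 1)).quotKerEquivOfSurjective (R.surjective (i + 1))).symm.toLinearMap
  have hβ : ∀ x, β (R.g (i + 1) x) = (LinearMap.range u).mkQ (α x) := by
    intro x
    have : ((R.g (i + 1)).quotKerEquivOfSurjective (R.surjective (i + 1))).symm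
        (R.g (i + 1) x) = Submodule.Quotient.mk x := by
      rw [LinearEquiv.symm_apply_eq]
      rfl
    simp [β, this]
  obtain ⟨γ, hγ⟩ := h i β
  have := R.projective i
  obtain ⟨δ, hδ⟩ := Module.projective_lifting_property (LinearMap.range u).mkQ γ
    (Submodule.mkQ_surjective _)
  let α' : R.P (i + 1) →ₗ[S] J := α - (δ.comp (R.f i)).comp (R.g (i + 1))
  have hα' : ∀ x, α' x ∈ LinearMap.range u := by
    intro x
    have hx : α' x = α x - δ (R.f i (R.g (i + 1) x)) := rfl
    rw [← Submodule.Quotient.mk_eq_zero, ← Submodule.mkQ_apply, hx, map_sub, sub_eq_zero, ← hβ,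
      ← hγ, ← hδ]
    rfl
  let v := LinearEquiv.ofInjective u hu
  refine ⟨v.symm.toLinearMap.comp (α'.codRestrict _ hα'), LinearMap.ext fun x => ?_⟩
  simp only [LinearMap.comp_apply, LinearEquiv.coe_coe, LinearEquiv.symm_apply_eq]
  ext
  have h1 := LinearMap.congr_fun hα x
  simp only [LinearMap.comp_apply] at h1
  simp [α', v, h1, (R.exact (i + 1)).apply_apply_eq_zero x]

theorem extends_of_injDimLE (n : ℕ) (N : ModuleCat.{0} S) (h : injDimLE S n N) :
    R.Extends N := by
  induction n generalizing N with
  | zero =>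
    have : Module.Injective S N := h
    exact R.extends_of_injective N
  | succ n ih =>
    obtain ⟨J, u, hJ, hu, h⟩ := h
    exact R.extends_of_quotient u hu (ih _ h)

theorem not_injDimLE {N : ModuleCat.{0} S} {i : Fin 3} (e : N ≃ₗ[S] R.K i) (n : ℕ) :
    ¬ injDimLE S n N := by
  intro h
  obtain ⟨i, rfl⟩ : ∃ j, i = j + 1 := ⟨i - 1, by simp⟩
  obtain ⟨ψ, hψ⟩ := R.extends_of_injDimLE n N h i e.symm.toLinearMap
  have hr : ∃ r : R.P i →ₗ[S] R.K (i + 1), r.comp (R.f i) = LinearMap.id :=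
    ⟨e.toLinearMap.comp ψ, by rw [LinearMap.comp_assoc, hψ]; ext x; simp⟩
  exact R.nonsplit i (((R.exact i).split_tfae (R.injective i) (R.surjective i)).out 0 1 |>.2 hr)

end PeriodicResolution

end Periodic

section RightIdeals

theorem mem_rIdeal {A : Type} [Ring A] {x z : A} : z ∈ rIdeal A x ↔ ∃ y, x * y = z := by
  rw [rIdeal, Submodule.mem_span_singleton]
  exact ⟨fun ⟨y, hy⟩ => ⟨y.unop, hy⟩, fun ⟨y, hy⟩ => ⟨op y, hy⟩⟩

/-- Left multiplication by `a`, as an endomorphism of the right module `A`. -/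
def leftMul {A : Type} [Ring A] (a : A) : A →ₗ[Aᵐᵒᵖ] A where
  toFun x := a * x
  map_add' := mul_add a
  map_smul' y x := (mul_assoc a x y.unop).symm

@[simp]
theorem leftMul_apply {A : Type} [Ring A] (a x : A) : leftMul a x = a * x := rfl

theorem projective_rIdeal {A : Type} [Ring A] {e : A} (he : e * e = e) :
    Module.Projective Aᵐᵒᵖ (rIdeal A e) := by
  have : Module.Projective Aᵐᵒᵖ A :=
    Module.Projective.of_equiv (MulOpposite.opLinearEquiv Aᵐᵒᵖ (M := A)).symm
  refine Module.Projective.of_split (rIdeal A e).subtype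
    ((leftMul e).codRestrict _ fun x => mem_rIdeal.2 ⟨x, rfl⟩) (LinearMap.ext fun ⟨x, hx⟩ => ?_)
  obtain ⟨y, rfl⟩ := mem_rIdeal.1 hx
  ext
  simp [← mul_assoc, he]

/-- An oriented `3`-cycle of arrows `a i : i → i + 1` with `a i * a (i + 1) = 0` and an extra
arrow `b i` out of each vertex `i`, in an algebra where each right ideal `e i A` is spanned by
`e i`, `b i` and `a i A`. -/
structure RelationCycle (k A : Type) [Field k] [Ring A] [Algebra k A] where
  e : Fin 3 → A
  a : Fin 3 → A
  b : Fin 3 → A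
  e_mul_e : ∀ i, e i * e i = e i
  e_mul_a : ∀ i, e i * a i = a i
  e_succ_mul_a : ∀ i, e (i + 1) * a i = 0
  a_mul_e : ∀ i, a i * e (i + 1) = a i
  a_mul_a : ∀ i, a i * a (i + 1) = 0
  b_mul_e : ∀ i, b i * e i = 0
  b_mul_a : ∀ i j, b i * a j = 0
  normal_form : ∀ i x, ∃ (c d : k) (y : A), e i * x = c • e i + d • b i + a i * y
  a_mul_b : ∀ i, a i * b (i + 1) ≠ 0

namespace RelationCycle

variable {k A : Type} [Field k] [Ring A] [Algebra k A] (C : RelationCycle k A)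

theorem a_ne_zero (i : Fin 3) : C.a i ≠ 0 := fun h => C.a_mul_b i (by rw [h, zero_mul])

theorem a_mul_eq_zero_iff (i : Fin 3) (x : A) :
    C.a i * x = 0 ↔ C.e (i + 1) * x ∈ rIdeal A (C.a (i + 1)) := by
  rw [mem_rIdeal]
  constructor
  · intro h
    obtain ⟨c, d, y, hy⟩ := C.normal_form (i + 1) x
    have h0 : c • C.a i + d • (C.a i * C.b (i + 1)) = 0 := by
      have := congrArg (C.a i * ·) hy
      simpa [mul_add, ← mul_assoc, C.a_mul_e, C.a_mul_a, h] using this.symm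
    have hc : c = 0 := by
      have := congrArg (· * C.e (i + 1)) h0
      simpa [add_mul, mul_assoc, C.a_mul_e, C.b_mul_e, C.a_ne_zero] using this
    have hd : d = 0 := by simpa [hc, C.a_mul_b] using h0
    exact ⟨y, by simp [hy, hc, hd]⟩
  · rintro ⟨y, hy⟩
    rw [← C.a_mul_e, mul_assoc, ← hy, ← mul_assoc, C.a_mul_a, zero_mul]

theorem a_mul_mul_a (i : Fin 3) (y : A) : C.a i * y * C.a i = 0 := by
  obtain ⟨c, d, z, hz⟩ := C.normal_form (i + 1) y
  rw [← C.a_mul_e i, mul_assoc (C.a i), hz]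
  simp only [mul_add, add_mul, mul_assoc, mul_smul_comm, smul_mul_assoc, C.a_mul_e]
  rw [← mul_assoc _ (C.a (i + 1)), C.a_mul_a, C.b_mul_a]
  have : C.a i * C.a i = 0 := by
    nth_rewrite 1 [← C.a_mul_e i]
    rw [mul_assoc, C.e_succ_mul_a, mul_zero]
  simp [this]

theorem rIdeal_a_le (i : Fin 3) : rIdeal A (C.a i) ≤ rIdeal A (C.e i) := by
  intro x hx
  obtain ⟨y, rfl⟩ := mem_rIdeal.1 hx
  exact mem_rIdeal.2 ⟨C.a i * y, by rw [← mul_assoc, C.e_mul_a]⟩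

/-- The surjection `e (i + 1) A → a i A`. -/
def cover (i : Fin 3) : rIdeal A (C.e (i + 1)) →ₗ[Aᵐᵒᵖ] rIdeal A (C.a i) :=
  ((leftMul (C.a i)).comp (Submodule.subtype _)).codRestrict _ fun x => mem_rIdeal.2 ⟨x, rfl⟩

theorem coe_cover (i : Fin 3) (x : rIdeal A (C.e (i + 1))) : (C.cover i x : A) = C.a i * x := rfl

theorem cover_eq_zero_iff (i : Fin 3) (x : rIdeal A (C.e (i + 1))) :
    C.cover i x = 0 ↔ (x : A) ∈ rIdeal A (C.a (i + 1)) := by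
  obtain ⟨x, hx⟩ := x
  obtain ⟨y, rfl⟩ := mem_rIdeal.1 hx
  rw [← Subtype.coe_inj, coe_cover, Submodule.coe_zero, a_mul_eq_zero_iff, ← mul_assoc, C.e_mul_e]

theorem cover_surjective (i : Fin 3) : Function.Surjective (C.cover i) := by
  rintro ⟨x, hx⟩
  obtain ⟨y, rfl⟩ := mem_rIdeal.1 hx
  refine ⟨⟨C.e (i + 1) * y, mem_rIdeal.2 ⟨y, rfl⟩⟩, Subtype.ext ?_⟩
  rw [coe_cover, ← mul_assoc, C.a_mul_e]

theorem cover_nonsplit (i : Fin 3) :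
    ¬ ∃ s : rIdeal A (C.a i) →ₗ[Aᵐᵒᵖ] rIdeal A (C.e (i + 1)),
      (C.cover i).comp s = LinearMap.id := by
  rintro ⟨s, hs⟩
  let a : rIdeal A (C.a i) := ⟨C.a i, mem_rIdeal.2 ⟨1, mul_one _⟩⟩
  let e : rIdeal A (C.e (i + 1)) := ⟨C.e (i + 1), mem_rIdeal.2 ⟨1, mul_one _⟩⟩
  have h0 : C.cover i (e - s a) = 0 := by
    rw [map_sub, sub_eq_zero]
    refine Eq.trans (Subtype.ext ?_) (LinearMap.congr_fun hs a).symm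
    exact C.a_mul_e i
  obtain ⟨y, hy⟩ := mem_rIdeal.1 ((C.cover_eq_zero_iff i _).1 h0)
  have h1 : (s a : A) * C.a (i + 1) = 0 := by
    have h2 : (op (C.a (i + 1)) : Aᵐᵒᵖ) • a = 0 := Subtype.ext (C.a_mul_a i)
    have := congrArg Subtype.val (s.map_smul (op (C.a (i + 1))) a)
    rw [h2, map_zero] at this
    exact this.symm
  have h3 := C.a_mul_mul_a (i + 1) y
  rw [hy] at h3
  refine C.a_ne_zero (i + 1) ?_
  have h4 : (e - s a : A) * C.a (i + 1) = C.a (i + 1) := by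
    rw [sub_mul, h1, sub_zero]
    exact C.e_mul_a _
  exact h4.symm.trans h3

/-- The sequences `0 → a (i + 1) A → e (i + 1) A → a i A → 0`. -/
def resolution : PeriodicResolution Aᵐᵒᵖ where
  K i := ModuleCat.of Aᵐᵒᵖ (rIdeal A (C.a i))
  P i := ModuleCat.of Aᵐᵒᵖ (rIdeal A (C.e (i + 1)))
  f i := Submodule.inclusion (C.rIdeal_a_le (i + 1))
  g i := C.cover i
  projective i := projective_rIdeal (C.e_mul_e (i + 1))
  injective i := Submodule.inclusion_injective _
  surjective i := C.cover_surjective i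
  exact i x := by
    refine (C.cover_eq_zero_iff i x).trans ⟨fun h => ⟨⟨x, h⟩, rfl⟩, ?_⟩
    rintro ⟨y, rfl⟩
    exact y.2
  nonsplit i := C.cover_nonsplit i

end RelationCycle

end RightIdeals

section GentleAlgebra

variable {k : Type} [Field k] {Q : QuiverData} {Rel : Set (Fin Q.nE × Fin Q.nE)}

theorem vtxA_mul_vtxA (v w : Fin Q.nV) :
    vtxA k Q Rel v * vtxA k Q Rel w = if v = w then vtxA k Q Rel v else 0 := by
  have h : vtx k Q v * vtx k Q w = if v = w then vtx k Q v else 0 := by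
    have := RingQuot.mkAlgHom_rel k (PathRel.vtx_mul (k := k) v w)
    rw [map_mul] at this
    refine this.trans ?_
    split_ifs
    · rfl
    · exact map_zero _
  rw [vtxA, vtxA, ← map_mul, h]
  split_ifs <;> simp

theorem vtxA_src_mul_arrA (e : Fin Q.nE) :
    vtxA k Q Rel (Q.src e) * arrA k Q Rel e = arrA k Q Rel e := by
  have h : vtx k Q (Q.src e) * arr k Q e = arr k Q e := by
    have := RingQuot.mkAlgHom_rel k (PathRel.src_arr (k := k) e)
    rwa [map_mul] at this
  rw [vtxA, arrA, ← map_mul, h]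

theorem arrA_mul_vtxA_tgt (e : Fin Q.nE) :
    arrA k Q Rel e * vtxA k Q Rel (Q.tgt e) = arrA k Q Rel e := by
  have h : arr k Q e * vtx k Q (Q.tgt e) = arr k Q e := by
    have := RingQuot.mkAlgHom_rel k (PathRel.arr_tgt (k := k) e)
    rwa [map_mul] at this
  rw [vtxA, arrA, ← map_mul, h]

theorem vtxA_mul_arrA (v : Fin Q.nV) (e : Fin Q.nE) :
    vtxA k Q Rel v * arrA k Q Rel e = if v = Q.src e then arrA k Q Rel e else 0 := by
  rw [← vtxA_src_mul_arrA, ← mul_assoc, vtxA_mul_vtxA]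
  split_ifs with h <;> simp [h]

theorem arrA_mul_vtxA (e : Fin Q.nE) (v : Fin Q.nV) :
    arrA k Q Rel e * vtxA k Q Rel v = if Q.tgt e = v then arrA k Q Rel e else 0 := by
  rw [← arrA_mul_vtxA_tgt, mul_assoc, vtxA_mul_vtxA]
  split_ifs with h <;> simp

theorem arrA_mul_arrA_of_ne {e f : Fin Q.nE} (h : Q.tgt e ≠ Q.src f) :
    arrA k Q Rel e * arrA k Q Rel f = 0 := by
  rw [← arrA_mul_vtxA_tgt, mul_assoc, vtxA_mul_arrA, if_neg h, mul_zero]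

theorem arrA_mul_arrA_of_mem {e f : Fin Q.nE} (h : (e, f) ∈ Rel) :
    arrA k Q Rel e * arrA k Q Rel f = 0 := by
  have := RingQuot.mkAlgHom_rel k
    (show GRel k Q Rel (arr k Q e * arr k Q f) 0 from ⟨⟨(e, f), h, rfl⟩, rfl⟩)
  rw [map_mul, map_zero] at this
  exact this

/-- A `k`-subspace stable under right multiplication by the trivial paths and the arrows is stable
under right multiplication by the algebra. -/
theorem mul_mem_of_generators (W : Submodule k (GAlg k Q Rel))
    (hv : ∀ w ∈ W, ∀ v, w * vtxA k Q Rel v ∈ W) (ha : ∀ w ∈ W, ∀ e, w * arrA k Q Rel e ∈ W)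
    {w : GAlg k Q Rel} (hw : w ∈ W) (x : GAlg k Q Rel) : w * x ∈ W := by
  obtain ⟨x, rfl⟩ : ∃ y, gmap k Q Rel y = x := RingQuot.mkAlgHom_surjective k _ x
  obtain ⟨x, rfl⟩ : ∃ y, (RingQuot.mkAlgHom k (PathRel k Q) y : PathAlg k Q) = x :=
    RingQuot.mkAlgHom_surjective k _ x
  induction x generalizing w with
  | grade0 r =>
    have : gmap k Q Rel (RingQuot.mkAlgHom k (PathRel k Q) (algebraMap k _ r)) =
        algebraMap k _ r :=
      AlgHom.commutes ((gmap k Q Rel).comp (RingQuot.mkAlgHom k (PathRel k Q))) r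
    rw [this, ← Algebra.commutes, ← Algebra.smul_def]
    exact W.smul_mem r hw
  | grade1 x =>
    cases x with
    | inl v => exact hv w hw v
    | inr e => exact ha w hw e
  | mul x y hx hy =>
    have : gmap k Q Rel (RingQuot.mkAlgHom k (PathRel k Q) (x * y)) =
        gmap k Q Rel (RingQuot.mkAlgHom k (PathRel k Q) x) *
        gmap k Q Rel (RingQuot.mkAlgHom k (PathRel k Q) y) :=
      map_mul ((gmap k Q Rel).comp (RingQuot.mkAlgHom k (PathRel k Q))) x y
    rw [this, ← mul_assoc]
    exact hy (hx hw)
  | add x y hx hy =>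
    have : gmap k Q Rel (RingQuot.mkAlgHom k (PathRel k Q) (x + y)) =
        gmap k Q Rel (RingQuot.mkAlgHom k (PathRel k Q) x) +
        gmap k Q Rel (RingQuot.mkAlgHom k (PathRel k Q) y) :=
      map_add ((gmap k Q Rel).comp (RingQuot.mkAlgHom k (PathRel k Q))) x y
    rw [this, mul_add]
    exact W.add_mem (hx hw) (hy hw)

/-- The universal property of `kQ/I`. -/
theorem exists_algHom {B : Type} [Ring B] [Algebra k B] (E : Fin Q.nV → B) (X : Fin Q.nE → B)
    (hE : ∀ v w, E v * E w = if v = w then E v else 0) (h1 : ∑ v, E v = 1)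
    (hs : ∀ e, E (Q.src e) * X e = X e) (ht : ∀ e, X e * E (Q.tgt e) = X e)
    (hR : ∀ p ∈ Rel, X p.1 * X p.2 = 0) :
    ∃ φ : GAlg k Q Rel →ₐ[k] B,
      (∀ v, φ (vtxA k Q Rel v) = E v) ∧ ∀ e, φ (arrA k Q Rel e) = X e := by
  have hψ : ∀ ⦃x y⦄, PathRel k Q x y →
      FreeAlgebra.lift k (Sum.elim E X) x = FreeAlgebra.lift k (Sum.elim E X) y := by
    rintro _ _ (⟨v, w⟩ | _ | e | e)
    · rw [map_mul]
      split_ifs with h <;> simp [hE, h]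
    · simp [h1]
    · simp [hs]
    · simp [ht]
  let ψ : PathAlg k Q →ₐ[k] B := RingQuot.liftAlgHom k ⟨_, hψ⟩
  have hψv : ∀ v, ψ (vtx k Q v) = E v := fun v =>
    (RingQuot.liftAlgHom_mkAlgHom_apply k _ hψ _).trans (by simp)
  have hψa : ∀ e, ψ (arr k Q e) = X e := fun e =>
    (RingQuot.liftAlgHom_mkAlgHom_apply k _ hψ _).trans (by simp)
  have hφ : ∀ ⦃x y⦄, GRel k Q Rel x y → ψ x = ψ y := by
    rintro _ _ ⟨⟨p, hp, rfl⟩, rfl⟩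
    rw [map_mul, hψa, hψa, hR p hp, map_zero]
  exact ⟨RingQuot.liftAlgHom k ⟨ψ, hφ⟩,
    fun v => (RingQuot.liftAlgHom_mkAlgHom_apply k _ hφ _).trans (hψv v),
    fun e => (RingQuot.liftAlgHom_mkAlgHom_apply k _ hφ _).trans (hψa e)⟩

end GentleAlgebra

section Stmt15

variable (k : Type) [Field k]

theorem normal_form15 (i : Fin 3) (x : GAlg k Q15 Rel15) :
    ∃ (c d : k) (y : GAlg k Q15 Rel15),
    vtxA k Q15 Rel15 (![0, 1, 2] i) * x = c • vtxA k Q15 Rel15 (![0, 1, 2] i) +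
      d • arrA k Q15 Rel15 (![3, 4, 5] i) + arrA k Q15 Rel15 (![0, 1, 2] i) * y := by
  let W : Submodule k (GAlg k Q15 Rel15) :=
    Submodule.span k {vtxA k Q15 Rel15 (![0, 1, 2] i)} ⊔
      Submodule.span k {arrA k Q15 Rel15 (![3, 4, 5] i)} ⊔
      LinearMap.range (LinearMap.mulLeft k (arrA k Q15 Rel15 (![0, 1, 2] i)))
  have hW : ∀ z, z ∈ W ↔ ∃ (c d : k) (y : GAlg k Q15 Rel15),
      z = c • vtxA k Q15 Rel15 (![0, 1, 2] i) +
      d • arrA k Q15 Rel15 (![3, 4, 5] i) + arrA k Q15 Rel15 (![0, 1, 2] i) * y := by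
    intro z
    simp only [W, Submodule.mem_sup, Submodule.mem_span_singleton, LinearMap.mem_range,
      LinearMap.mulLeft_apply]
    constructor
    · rintro ⟨_, ⟨_, ⟨c, rfl⟩, _, ⟨d, rfl⟩, rfl⟩, _, ⟨y, rfl⟩, rfl⟩
      exact ⟨c, d, y, rfl⟩
    · rintro ⟨c, d, y, rfl⟩
      exact ⟨_, ⟨_, ⟨c, rfl⟩, _, ⟨d, rfl⟩, rfl⟩, _, ⟨y, rfl⟩, rfl⟩
  have he : vtxA k Q15 Rel15 (![0, 1, 2] i) ∈ W := (hW _).2 ⟨1, 0, 0, by simp⟩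
  have hb : arrA k Q15 Rel15 (![3, 4, 5] i) ∈ W := (hW _).2 ⟨0, 1, 0, by simp⟩
  have ha : ∀ y, arrA k Q15 Rel15 (![0, 1, 2] i) * y ∈ W := fun y => (hW _).2 ⟨0, 0, y, by simp⟩
  refine (hW _).1 (mul_mem_of_generators W ?_ ?_ he x)
  · intro w hw v
    obtain ⟨c, d, y, rfl⟩ := (hW w).1 hw
    rw [add_mul, add_mul, smul_mul_assoc, smul_mul_assoc, mul_assoc, vtxA_mul_vtxA, arrA_mul_vtxA]
    refine W.add_mem (W.add_mem (W.smul_mem _ ?_) (W.smul_mem _ ?_)) (ha _)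
    · split_ifs
      exacts [he, W.zero_mem]
    · split_ifs
      exacts [hb, W.zero_mem]
  · intro w hw f
    obtain ⟨c, d, y, rfl⟩ := (hW w).1 hw
    have hbf : arrA k Q15 Rel15 (![3, 4, 5] i) * arrA k Q15 Rel15 f = 0 :=
      arrA_mul_arrA_of_ne (by clear * -; revert i f; decide)
    rw [add_mul, add_mul, smul_mul_assoc, smul_mul_assoc, mul_assoc, vtxA_mul_arrA, hbf, smul_zero,
      add_zero]
    refine W.add_mem (W.smul_mem _ ?_) (ha _)
    split_ifs with hf
    · obtain rfl | rfl : f = ![0, 1, 2] i ∨ f = ![3, 4, 5] i := by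
        clear * - hf; revert i f; decide
      · simpa using ha 1
      · exact hb
    · exact W.zero_mem

open Matrix in
theorem mul_ne_zero15 (i : Fin 3) : arrA k Q15 Rel15 (![0, 1, 2] i) *
    arrA k Q15 Rel15 (![3, 4, 5] (i + 1)) ≠ 0 := by
  let X : Fin Q15.nE → Matrix (Fin 6) (Fin 6) k := fun f =>
    if f = ![0, 1, 2] i ∨ f = ![3, 4, 5] (i + 1) then single (Q15.src f) (Q15.tgt f) 1 else 0
  obtain ⟨φ, -, hφ⟩ := exists_algHom (k := k) (Q := Q15) (Rel := Rel15)
    (B := Matrix (Fin 6) (Fin 6) k) (fun v => single v v (1 : k)) X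
    (by
      intro v w
      split_ifs with h
      · simp [h]
      · simp [single_mul_single_of_ne, h])
    (by
      simp only [Fin.sum_univ_six]
      ext i j
      fin_cases i <;> fin_cases j <;> simp)
    (by intro f; simp only [X]; split_ifs <;> simp)
    (by intro f; simp only [X]; split_ifs <;> simp)
    (by
      rintro ⟨f, g⟩ hp
      simp only [X]
      split_ifs with h1 h2
      · exfalso
        simp only [Rel15, Set.mem_insert_iff, Set.mem_singleton_iff] at hp
        revert i f g
        decide
      all_goals simp)
  intro h
  have := congrArg φ h
  rw [map_mul, map_zero, hφ, hφ] at this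
  have h1 : X (![0, 1, 2] i) = single (Q15.src (![0, 1, 2] i)) (Q15.tgt (![0, 1, 2] i)) 1 :=
    if_pos (Or.inl rfl)
  have h2 : X (![3, 4, 5] (i + 1)) =
      single (Q15.src (![3, 4, 5] (i + 1))) (Q15.tgt (![3, 4, 5] (i + 1))) 1 :=
    if_pos (Or.inr rfl)
  have hi : Q15.tgt (![0, 1, 2] i) = Q15.src (![3, 4, 5] (i + 1)) := by
    clear * -; revert i; decide
  rw [h1, h2, hi, single_mul_single_same] at this
  simpa using congrFun (congrFun this (Q15.src (![0, 1, 2] i))) (Q15.tgt (![3, 4, 5] (i + 1)))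

/-- The algebra `A` with the cycle `a_1 a_2 a_3` and the arrows `a_4`, `a_5`, `a_6`. -/
def relationCycle15 : RelationCycle k (GAlg k Q15 Rel15) where
  e i := vtxA k Q15 Rel15 (![0, 1, 2] i)
  a i := arrA k Q15 Rel15 (![0, 1, 2] i)
  b i := arrA k Q15 Rel15 (![3, 4, 5] i)
  e_mul_e i := by rw [vtxA_mul_vtxA, if_pos rfl]
  e_mul_a i := by rw [vtxA_mul_arrA, if_pos (by revert i; decide)]
  e_succ_mul_a i := by rw [vtxA_mul_arrA, if_neg (by revert i; decide)]
  a_mul_e i := by rw [arrA_mul_vtxA, if_pos (by revert i; decide)]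
  a_mul_a i := arrA_mul_arrA_of_mem (by
    simp only [Rel15, Set.mem_insert_iff, Set.mem_singleton_iff]; revert i; decide)
  b_mul_e i := by rw [arrA_mul_vtxA, if_neg (by revert i; decide)]
  b_mul_a i j := arrA_mul_arrA_of_ne (by revert i j; decide)
  normal_form := normal_form15 k
  a_mul_b := mul_ne_zero15 k

theorem qmap_self {R : Type} [Ring R] (ε : R) : qmap R ε ε = 0 :=
  (RingQuot.mkRingHom_rel (show QuotRel R ε ε 0 from ⟨rfl, rfl⟩)).trans (map_zero _)

open Matrix in
/-- The representation of `A` on the module with top `S(1)` and socle `S(4)`. -/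
theorem exists_rep15 : ∃ φ : GAlg k Q15 Rel15 →ₐ[k] Matrix (Fin 2) (Fin 2) k,
    φ (vtxA k Q15 Rel15 0) = single 0 0 1 ∧ φ (vtxA k Q15 Rel15 1) = 0 ∧
    φ (arrA k Q15 Rel15 0) = 0 ∧ φ (arrA k Q15 Rel15 3) = single 0 1 1 := by
  obtain ⟨φ, hv, ha⟩ := exists_algHom (k := k) (Q := Q15) (Rel := Rel15)
    (B := Matrix (Fin 2) (Fin 2) k)
    (fun v => if v = 0 then single 0 0 1 else if v = 3 then single 1 1 1 else 0)
    (fun f => if f = 3 then single 0 1 1 else 0)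
    (by intro v w; fin_cases v <;> fin_cases w <;> simp)
    (by
      simp only [Fin.sum_univ_six]
      ext i j
      fin_cases i <;> fin_cases j <;> simp)
    (by intro f; fin_cases f <;> simp)
    (by intro f; fin_cases f <;> simp)
    (by
      rintro p hp
      simp only [Rel15, Set.mem_insert_iff, Set.mem_singleton_iff] at hp
      obtain rfl | rfl | rfl := hp <;> simp)
  exact ⟨φ, by simp [hv], by simp [hv], by simp [ha], by simp [ha]⟩

theorem qmap_eq_zero_iff15 (x : GAlg k Q15 Rel15) :
    qmap _ (vtxA k Q15 Rel15 1) (vtxA k Q15 Rel15 0 * x) = 0 ↔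
      vtxA k Q15 Rel15 0 * x ∈ rIdeal _ (arrA k Q15 Rel15 0) := by
  constructor
  · intro h
    obtain ⟨φ, he, hε, ha, hb⟩ := exists_rep15 k
    have hφ : ∀ ⦃x y⦄, QuotRel _ (vtxA k Q15 Rel15 1) x y →
        φ.toRingHom x = φ.toRingHom y := by
      rintro _ _ ⟨rfl, rfl⟩
      simp [hε]
    have h0 : φ (vtxA k Q15 Rel15 0 * x) = 0 := by
      have h1 := congrArg (RingQuot.lift ⟨_, hφ⟩) h
      exact (RingQuot.lift_mkRingHom_apply _ hφ _).symm.trans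
        (h1.trans (map_zero (RingQuot.lift ⟨φ.toRingHom, hφ⟩)))
    obtain ⟨c, d, y, hy⟩ := (relationCycle15 k).normal_form 0 x
    have hy' : vtxA k Q15 Rel15 0 * x =
      c • vtxA k Q15 Rel15 0 + d • arrA k Q15 Rel15 3 + arrA k Q15 Rel15 0 * y := hy
    rw [hy'] at h0 ⊢
    simp only [map_add, map_smul, map_mul, he, ha, hb, zero_mul, add_zero] at h0
    have hc : c = 0 := by simpa using congrFun (congrFun h0 0) 0
    have hd : d = 0 := by simpa using congrFun (congrFun h0 0) 1
    exact mem_rIdeal.2 ⟨y, by simp [hc, hd]⟩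
  · intro h
    obtain ⟨y, hy⟩ := mem_rIdeal.1 h
    have ha : arrA k Q15 Rel15 0 * vtxA k Q15 Rel15 1 = arrA k Q15 Rel15 0 :=
      arrA_mul_vtxA_tgt (Q := Q15) 0
    rw [← hy, ← ha, map_mul, map_mul, qmap_self, mul_zero, zero_mul]

theorem nonempty_equiv15 :
    letI : Module (GAlg k Q15 Rel15)ᵐᵒᵖ (rIdeal (QuotBy _ (vtxA k Q15 Rel15 1))
      (qmap _ (vtxA k Q15 Rel15 1) (vtxA k Q15 Rel15 0))) :=
      modRestrict (qmap _ (vtxA k Q15 Rel15 1)) _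
    Nonempty (rIdeal (QuotBy _ (vtxA k Q15 Rel15 1))
      (qmap _ (vtxA k Q15 Rel15 1) (vtxA k Q15 Rel15 0)) ≃ₗ[(GAlg k Q15 Rel15)ᵐᵒᵖ]
      rIdeal _ (arrA k Q15 Rel15 2)) := by
  let _ : Module (GAlg k Q15 Rel15)ᵐᵒᵖ (rIdeal (QuotBy _ (vtxA k Q15 Rel15 1))
      (qmap _ (vtxA k Q15 Rel15 1) (vtxA k Q15 Rel15 0))) :=
      modRestrict (qmap _ (vtxA k Q15 Rel15 1)) _
  let p : GAlg k Q15 Rel15 →ₗ[(GAlg k Q15 Rel15)ᵐᵒᵖ] rIdeal (QuotBy _ (vtxA k Q15 Rel15 1))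
      (qmap _ (vtxA k Q15 Rel15 1) (vtxA k Q15 Rel15 0)) :=
    { toFun x := ⟨qmap _ _ (vtxA k Q15 Rel15 0 * x), mem_rIdeal.2 ⟨qmap _ _ x, by rw [map_mul]⟩⟩
      map_add' x y := Subtype.ext (by simp [mul_add])
      map_smul' x y := Subtype.ext (by
        change qmap _ _ (vtxA k Q15 Rel15 0 * (y * x.unop)) =
          qmap _ _ (vtxA k Q15 Rel15 0 * y) * qmap _ _ x.unop
        rw [← map_mul, mul_assoc]) }
  let q : GAlg k Q15 Rel15 →ₗ[(GAlg k Q15 Rel15)ᵐᵒᵖ] rIdeal _ (arrA k Q15 Rel15 2) :=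
    (leftMul (arrA k Q15 Rel15 2)).codRestrict _ fun x => mem_rIdeal.2 ⟨x, rfl⟩
  have hp : Function.Surjective p := by
    rintro ⟨x, hx⟩
    obtain ⟨y, rfl⟩ := mem_rIdeal.1 hx
    obtain ⟨y, rfl⟩ : ∃ z, qmap _ (vtxA k Q15 Rel15 1) z = y := RingQuot.mkRingHom_surjective _ y
    exact ⟨y, Subtype.ext (map_mul _ _ _)⟩
  have hq : Function.Surjective q := by
    rintro ⟨x, hx⟩
    obtain ⟨y, rfl⟩ := mem_rIdeal.1 hx
    exact ⟨y, rfl⟩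
  have hpq : LinearMap.ker p = LinearMap.ker q := by
    ext x
    rw [LinearMap.mem_ker, LinearMap.mem_ker, ← Subtype.coe_inj, ← Subtype.coe_inj]
    exact (qmap_eq_zero_iff15 k x).trans ((relationCycle15 k).a_mul_eq_zero_iff 2 x).symm
  exact ⟨(p.quotKerEquivOfSurjective hp).symm.trans
    ((Submodule.quotEquivOfEq _ _ hpq).trans (q.quotKerEquivOfSurjective hq))⟩

end Stmt15

/-- Remark `rmk: rmk of main 2` (3).  For the gentle algebra
`A = kQ/⟨a_1a_2, a_2a_3, a_3a_1⟩` above and the uniserial right `A`-module `M`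
with top `S(1)` and socle `S(4)` (i.e. the indecomposable projective
`Ā = A/Aε_2A`-module at vertex `1`, viewed as an `A`-module):
(i) `Ext¹_A(a_2A, M) ≠ 0`, i.e. there is a non-split extension of `a_2A` by `M`;
(ii) `M` has infinite projective dimension over `A`;
(iii) `M` has infinite injective dimension over `A`. -/
theorem stmt15 (k : Type) [Field k] [IsAlgClosed k] :
    let A := GAlg k Q15 Rel15
    let ε := vtxA k Q15 Rel15 1
    let Abar := QuotBy A ε
    let π := qmap A ε
    let M := ↥(rIdeal Abar (π (vtxA k Q15 Rel15 0)))
    letI : Module Aᵐᵒᵖ M := modRestrict π M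
    (∃ (E : ModuleCat.{0} Aᵐᵒᵖ) (f : M →ₗ[Aᵐᵒᵖ] E)
        (g : E →ₗ[Aᵐᵒᵖ] ↥(rIdeal A (arrA k Q15 Rel15 1))),
        Function.Injective f ∧ Function.Surjective g ∧
        LinearMap.range f = LinearMap.ker g ∧
        ¬ ∃ s : ↥(rIdeal A (arrA k Q15 Rel15 1)) →ₗ[Aᵐᵒᵖ] E,
          g.comp s = LinearMap.id) ∧
      (∀ n, ¬ projDimLE Aᵐᵒᵖ n (ModuleCat.of Aᵐᵒᵖ M)) ∧
      (∀ n, ¬ injDimLE Aᵐᵒᵖ n (ModuleCat.of Aᵐᵒᵖ M)) := by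
  intro A ε Abar π M
  let _ : Module Aᵐᵒᵖ M := modRestrict π M
  obtain ⟨φ⟩ := nonempty_equiv15 k
  let R := (relationCycle15 k).resolution
  let e : M ≃ₗ[Aᵐᵒᵖ] R.K 2 := φ
  refine ⟨⟨R.P 1, (R.f 1).comp e.toLinearMap, R.g 1, (R.injective 1).comp e.injective,
    R.surjective 1, ?_, R.nonsplit 1⟩, R.not_projDimLE (N := ModuleCat.of Aᵐᵒᵖ M) e,
    R.not_injDimLE (N := ModuleCat.of Aᵐᵒᵖ M) e⟩
  rw [LinearMap.range_comp, LinearEquiv.range, Submodule.map_top]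
  exact (R.exact 1).linearMap_ker_eq.symm
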